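/- Let L ∈ B(H,G) with 0 < ‖L‖ ≤ 1, let g : G → (−∞,+∞] be proper with a continuous affine minorant, and let γ > 0. (i) If L is an isometry (L* ∘ L = Id_H), then L ⊙_γ g = L ⊚_γ g. (ii) If L is a coisometry (L ∘ L* = Id_G), then L ⊙_γ g = L* ▷ g** with the infimum attained wherever finite (where (L* ▷ g**)(x) = inf { g**(y) : y ∈ G, L*y = x }), and L ⊚_γ g = g** ∘ L. (iii) If L is invertible with L⁻¹ = L*, then L ⊙_γ g = L* ▷ g** = g** ∘ L = L ⊚_γ g. -/

import Mathlib

open scoped RealInnerProductSpace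
open Filter Set

noncomputable section

/-- Fenchel (Legendre) conjugate of an extended-real-valued function. -/
def fconj {H : Type*} [NormedAddCommGroup H] [InnerProductSpace ℝ H]
    (f : H → EReal) : H → EReal :=
  fun xs => ⨆ x : H, (⟪x, xs⟫ : EReal) - f x

/-- Moreau envelope of index `γ`. -/
def menv {H : Type*} [NormedAddCommGroup H] (γ : ℝ) (f : H → EReal) : H → EReal :=
  fun x => ⨅ y : H, f y + ((‖x - y‖ ^ 2 / (2 * γ) : ℝ) : EReal)

/-- Quadratic kernel `Q`. -/
def qk {H : Type*} [NormedAddCommGroup H] (x : H) : ℝ := ‖x‖ ^ 2 / 2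

/-- Proximal composition `L ⊙_γ g`. -/
def proxComp {H G : Type*} [NormedAddCommGroup H] [InnerProductSpace ℝ H]
    [NormedAddCommGroup G] [InnerProductSpace ℝ G]
    (L : H →L[ℝ] G) (γ : ℝ) (g : G → EReal) : H → EReal :=
  fun x => fconj (fun z => menv (1 / γ) (fconj g) (L z)) x - (((1 / γ) * qk x : ℝ) : EReal)

/-- Proximal cocomposition `L ⊚_γ g`. -/
def proxCocomp {H G : Type*} [NormedAddCommGroup H] [InnerProductSpace ℝ H]
    [NormedAddCommGroup G] [InnerProductSpace ℝ G]
    (L : H →L[ℝ] G) (γ : ℝ) (g : G → EReal) : H → EReal :=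
  fconj (proxComp L (1 / γ) (fconj g))

/-- `f` is proper: not identically `+∞` and never `−∞`. -/
def ProperE {H : Type*} (f : H → EReal) : Prop :=
  (∃ x, f x ≠ ⊤) ∧ ∀ x, f x ≠ ⊥

/-- `f` admits a continuous affine minorant. -/
def HasAffMinorant {H : Type*} [NormedAddCommGroup H] [InnerProductSpace ℝ H]
    (f : H → EReal) : Prop :=
  ∃ (u : H) (c : ℝ), ∀ x, ((⟪x, u⟫ + c : ℝ) : EReal) ≤ f x

/-- Convexity for extended-real-valued functions. -/
def ConvexE {H : Type*} [NormedAddCommGroup H] [InnerProductSpace ℝ H]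
    (f : H → EReal) : Prop :=
  ∀ x y : H, ∀ a b : ℝ, 0 < a → 0 < b → a + b = 1 →
    f (a • x + b • y) ≤ ((a : ℝ) : EReal) * f x + ((b : ℝ) : EReal) * f y

/-- The class `Γ₀`: proper, lower semicontinuous, convex. -/
def IsGamma0 {H : Type*} [NormedAddCommGroup H] [InnerProductSpace ℝ H]
    (f : H → EReal) : Prop :=
  ProperE f ∧ LowerSemicontinuous f ∧ ConvexE f

/-- `p` is a proximal point of `f` at `x`. -/
def IsProx {H : Type*} [NormedAddCommGroup H] (f : H → EReal) (x p : H) : Prop :=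
  ∀ y : H, f p + ((‖x - p‖ ^ 2 / 2 : ℝ) : EReal) ≤ f y + ((‖x - y‖ ^ 2 / 2 : ℝ) : EReal)

/-- Subdifferential. -/
def SubdiffE {H : Type*} [NormedAddCommGroup H] [InnerProductSpace ℝ H]
    (f : H → EReal) (x : H) : Set H :=
  {xs | ∀ y : H, (⟪y - x, xs⟫ : EReal) + f x ≤ f y}

/-- Recession function. -/
def recE {H : Type*} [NormedAddCommGroup H] (f : H → EReal) : H → EReal :=
  fun x => ⨆ y : {y : H // f y ≠ ⊤}, f (x + (y : H)) - f (y : H)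

end

section Helpers

open ContinuousLinearMap (adjoint)

variable {H G : Type*} [NormedAddCommGroup H] [NormedAddCommGroup G]

theorem EReal.le_of_forall_le_coe {a b : EReal} (h : ∀ r : ℝ, b ≤ r → a ≤ r) : a ≤ b := by
  induction b with
  | top => exact le_top
  | coe b => exact h b le_rfl
  | bot => exact (EReal.eq_bot_iff_forall_lt a).2 (fun y =>
      (h (y - 1) bot_le).trans_lt (EReal.coe_lt_coe_iff.2 (by linarith))) |>.le

theorem EReal.eq_of_forall_le_coe_iff {a b : EReal} (h : ∀ r : ℝ, a ≤ r ↔ b ≤ r) : a = b :=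
  le_antisymm (EReal.le_of_forall_le_coe fun r => (h r).2)
    (EReal.le_of_forall_le_coe fun r => (h r).1)

theorem EReal.coe_sub_le_coe_iff (a r : ℝ) (c : EReal) :
    (a : EReal) - c ≤ r ↔ ((a - r : ℝ) : EReal) ≤ c := by
  induction c with
  | top => simp
  | coe c => norm_cast; constructor <;> intro h <;> linarith
  | bot => simp [-EReal.coe_sub]

theorem EReal.coe_le_add_coe_iff (a b : ℝ) (c : EReal) :
    (a : EReal) ≤ c + b ↔ ((a - b : ℝ) : EReal) ≤ c := by
  induction c with
  | top => simp
  | coe c => norm_cast; constructor <;> intro h <;> linarith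
  | bot => simp [-EReal.coe_sub]

theorem EReal.sub_coe_le_coe_iff (a b : ℝ) (c : EReal) :
    c - b ≤ (a : EReal) ↔ c ≤ ((a + b : ℝ) : EReal) := by
  induction c with
  | top => simp [-EReal.coe_add]
  | coe c => norm_cast; constructor <;> intro h <;> linarith
  | bot => simp

theorem coe_le_menv_iff (f : H → EReal) (γ a : ℝ) (x : H) :
    (a : EReal) ≤ menv γ f x ↔
      ∀ y, ((a - ‖x - y‖ ^ 2 / (2 * γ) : ℝ) : EReal) ≤ f y := by
  simp only [menv, le_iInf_iff, EReal.coe_le_add_coe_iff]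

variable [InnerProductSpace ℝ H] [InnerProductSpace ℝ G]

theorem fconj_le_coe_iff (f : H → EReal) (w : H) (r : ℝ) :
    fconj f w ≤ r ↔ ∀ x, ((⟪x, w⟫ - r : ℝ) : EReal) ≤ f x := by
  simp only [fconj, iSup_le_iff, EReal.coe_sub_le_coe_iff]

theorem fconj_fconj_le (f : H → EReal) (x : H) : fconj (fconj f) x ≤ f x := by
  refine EReal.le_of_forall_le_coe fun r hr => (fconj_le_coe_iff _ _ _).2 fun y => ?_
  refine EReal.le_of_forall_le_coe fun t ht => ?_
  have h := ((fconj_le_coe_iff _ _ _).1 ht x).trans hr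
  rw [EReal.coe_le_coe_iff] at h ⊢
  rw [real_inner_comm]
  linarith

theorem fconj_fconj_fconj (f : H → EReal) : fconj (fconj (fconj f)) = fconj f := by
  refine funext fun x => le_antisymm (fconj_fconj_le _ x) ?_
  refine EReal.le_of_forall_le_coe fun r hr => (fconj_le_coe_iff _ _ _).2 fun y => ?_
  exact ((fconj_le_coe_iff _ _ _).1 hr y).trans (fconj_fconj_le f y)

theorem convex_epigraph_fconj (f : H → EReal) :
    Convex ℝ {p : H × ℝ | fconj f p.1 ≤ (p.2 : EReal)} := by
  rintro ⟨x, s⟩ hx ⟨y, t⟩ hy a b ha hb hab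
  simp only [Set.mem_ofPred_eq, fconj_le_coe_iff] at hx hy ⊢
  intro z
  refine le_trans ?_ (max_le (hx z) (hy z))
  rw [← EReal.coe_strictMono.monotone.map_max, EReal.coe_le_coe_iff]
  have h := Convex.combo_le_max (⟪z, x⟫ - s) (⟪z, y⟫ - t) ha hb hab
  simp only [Prod.fst_add, Prod.snd_add, Prod.smul_fst, Prod.smul_snd, inner_add_right,
    inner_smul_right, smul_eq_mul] at h ⊢
  linarith

/-- Sandwich theorem: an affine function fits between a continuous concave function and a larger
extended-real-valued convex one. -/
theorem exists_affine_between [CompleteSpace G] (f : G → EReal) (k : G → ℝ)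
    (hf : Convex ℝ {p : G × ℝ | f p.1 ≤ (p.2 : EReal)}) (hdom : ∃ y, f y ≠ ⊤)
    (hk : ConcaveOn ℝ univ k) (hkc : Continuous k) (hkf : ∀ y, (k y : EReal) ≤ f y) :
    ∃ (s : G) (c : ℝ), ∀ y, k y ≤ ⟪y, s⟫ + c ∧ ((⟪y, s⟫ + c : ℝ) : EReal) ≤ f y := by
  have hA : Convex ℝ {p : G × ℝ | p.2 < k p.1} := by
    simpa using hk.convex_strict_hypograph
  have hAo : IsOpen {p : G × ℝ | p.2 < k p.1} :=
    isOpen_lt continuous_snd (hkc.comp continuous_fst)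
  have hdisj : Disjoint {p : G × ℝ | p.2 < k p.1} {p : G × ℝ | f p.1 ≤ (p.2 : EReal)} := by
    rw [Set.disjoint_left]
    rintro ⟨y, t⟩ h1 h2
    exact absurd (EReal.coe_le_coe_iff.1 ((hkf y).trans h2)) (not_le.2 h1)
  obtain ⟨F, u, hFA, hFB⟩ := geometric_hahn_banach_open hA hAo hf hdisj
  set l : ℝ := F (0, 1) with hl
  set v : G := (InnerProductSpace.toDual ℝ G).symm (F.comp (ContinuousLinearMap.inl ℝ G ℝ)) with hv
  have hF : ∀ y t, F (y, t) = ⟪y, v⟫ + t * l := by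
    intro y t
    have h1 : ⟪y, v⟫ = F (y, 0) := by
      rw [real_inner_comm, hv, InnerProductSpace.toDual_symm_apply]
      simp
    rw [h1, hl, ← smul_eq_mul, ← map_smul, ← map_add]
    simp
  obtain ⟨y₀, hy₀⟩ := hdom
  have hlpos : 0 < l := by
    obtain ⟨t₀, ht₀, -⟩ := EReal.lt_iff_exists_real_btwn.1 (lt_top_iff_ne_top.2 hy₀)
    have h1 : k y₀ ≤ t₀ := EReal.coe_le_coe_iff.1 ((hkf y₀).trans ht₀.le)
    have h2 := hFA (y₀, k y₀ - 1) (by simp)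
    have h3 := hFB (y₀, t₀) ht₀.le
    rw [hF] at h2 h3
    nlinarith
  refine ⟨-(l⁻¹ • v), u / l, fun y => ?_⟩
  have e : ⟪y, -(l⁻¹ • v)⟫ + u / l = (u - ⟪y, v⟫) / l := by
    rw [inner_neg_right, inner_smul_right]
    field_simp
    ring
  rw [e]
  constructor
  · refine le_of_forall_lt fun t ht => ?_
    have h := hFA (y, t) ht
    rw [hF] at h
    rw [lt_div_iff₀ hlpos]
    linarith
  · refine EReal.le_of_forall_le_coe fun t ht => ?_
    have h := hFB (y, t) ht
    rw [hF] at h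
    rw [EReal.coe_le_coe_iff, div_le_iff₀ hlpos]
    linarith

theorem proxComp_le_coe_iff (L : H →L[ℝ] G) (g : G → EReal) {γ : ℝ} (hγ : 0 < γ) (x : H) (r : ℝ) :
    proxComp L γ g x ≤ r ↔ ∀ z y,
      ((⟪z, x⟫ - r - ‖x‖ ^ 2 / (2 * γ) - γ / 2 * ‖L z - y‖ ^ 2 : ℝ) : EReal) ≤ fconj g y := by
  simp only [proxComp, EReal.sub_coe_le_coe_iff, fconj_le_coe_iff (fun z => menv _ _ (L z)),
    coe_le_menv_iff, qk]
  refine forall_congr' fun z => forall_congr' fun y => ?_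
  have e : ⟪z, x⟫ - (r + 1 / γ * (‖x‖ ^ 2 / 2)) - ‖L z - y‖ ^ 2 / (2 * (1 / γ)) =
      ⟪z, x⟫ - r - ‖x‖ ^ 2 / (2 * γ) - γ / 2 * ‖L z - y‖ ^ 2 := by
    field_simp
    ring
  rw [e]

theorem proxCocomp_le_coe_iff (L : H →L[ℝ] G) (g : G → EReal) (γ : ℝ) (x : H) (r : ℝ) :
    proxCocomp L γ g x ≤ r ↔
      ∀ w, ((⟪w, x⟫ - r : ℝ) : EReal) ≤ proxComp L (1 / γ) (fconj g) w :=
  fconj_le_coe_iff _ _ _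

theorem exists_fconj_fconj_ne_top {g : G → EReal} (hg : ∃ y, g y ≠ ⊤) :
    ∃ y, fconj (fconj g) y ≠ ⊤ := by
  obtain ⟨y, hy⟩ := hg
  exact ⟨y, ne_top_of_le_ne_top hy (fconj_fconj_le g y)⟩

theorem exists_fconj_ne_top {g : G → EReal} (hm : HasAffMinorant g) : ∃ y, fconj g y ≠ ⊤ := by
  obtain ⟨u, c, h⟩ := hm
  refine ⟨u, ne_top_of_le_ne_top (EReal.coe_ne_top (-c)) ((fconj_le_coe_iff _ _ _).2 ?_)⟩
  simpa only [sub_neg_eq_add] using h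

theorem concaveOn_inner_sub_norm_sq (A : G →L[ℝ] G) (v : G) (t : ℝ) {δ : ℝ} (hδ : 0 ≤ δ) :
    ConcaveOn ℝ univ fun y => ⟪y, v⟫ - t - δ * ‖y - A y‖ ^ 2 := by
  have h1 : ConvexOn ℝ univ fun y : G => ‖y - A y‖ ^ 2 := by
    have := (convexOn_univ_norm (E := G)).pow (fun _ _ => norm_nonneg _) 2
    exact this.comp_linearMap (ContinuousLinearMap.id ℝ G - A).toLinearMap
  have h2 : ConcaveOn ℝ univ fun y : G => ⟪y, v⟫ := by
    have := ((innerSL ℝ v).toLinearMap).concaveOn convex_univ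
    simpa [real_inner_comm] using this
  exact (h2.sub (convexOn_const t convex_univ)).sub (h1.smul hδ)

variable [CompleteSpace H] [CompleteSpace G]

/-- For an isometry the inner supremum in the proximal composition is explicit. -/
theorem proxComp_le_coe_iff_of_isometry {L : H →L[ℝ] G} (hL : ∀ x, adjoint L (L x) = x)
    (g : G → EReal) {γ : ℝ} (hγ : 0 < γ) (x : H) (r : ℝ) :
    proxComp L γ g x ≤ r ↔ ∀ y,
      ((⟪y, L x⟫ - r - γ / 2 * ‖y - L (adjoint L y)‖ ^ 2 : ℝ) : EReal) ≤ fconj g y := by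
  have key : ∀ z y, ⟪z, x⟫ - r - ‖x‖ ^ 2 / (2 * γ) - γ / 2 * ‖L z - y‖ ^ 2 =
      ⟪y, L x⟫ - r - γ / 2 * ‖y - L (adjoint L y)‖ ^ 2 -
        γ / 2 * ‖z - adjoint L y - γ⁻¹ • x‖ ^ 2 := by
    intro z y
    have hLL : ∀ a b, ⟪L a, L b⟫ = ⟪a, b⟫ := fun a b => by
      rw [← ContinuousLinearMap.adjoint_inner_left, hL]
    have hy : ∀ a, ⟪y, L a⟫ = ⟪adjoint L y, a⟫ := fun a => by
      rw [ContinuousLinearMap.adjoint_inner_left]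
    simp only [← real_inner_self_eq_norm_sq, inner_sub_left, inner_sub_right, inner_smul_left,
      inner_smul_right, hLL, hy, real_inner_comm y, real_inner_comm (adjoint L y),
      real_inner_comm x z, RCLike.conj_to_real]
    field_simp
    ring
  rw [proxComp_le_coe_iff L g hγ]
  constructor
  · intro h y
    have h' := h (adjoint L y + γ⁻¹ • x) y
    rw [key] at h'
    simpa using h'
  · intro h z y
    refine le_trans ?_ (h y)
    rw [key, EReal.coe_le_coe_iff]
    have := mul_nonneg (half_pos hγ).le (sq_nonneg ‖z - adjoint L y - γ⁻¹ • x‖)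
    linarith

theorem proxComp_eq_proxCocomp_of_isometry {L : H →L[ℝ] G} (hL : ∀ x, adjoint L (L x) = x)
    {g : G → EReal} (hg : ∃ y, g y ≠ ⊤) {γ : ℝ} (hγ : 0 < γ) :
    proxComp L γ g = proxCocomp L γ g := by
  refine funext fun x => EReal.eq_of_forall_le_coe_iff fun r => ?_
  have hγ' : 0 < 1 / γ := one_div_pos.2 hγ
  rw [proxComp_le_coe_iff_of_isometry hL g hγ, proxCocomp_le_coe_iff]
  constructor
  · intro h w
    refine EReal.le_of_forall_le_coe fun t ht => ?_
    rw [proxComp_le_coe_iff_of_isometry hL _ hγ'] at ht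
    obtain ⟨s, c, hsc⟩ := exists_affine_between (fconj (fconj g))
      (fun y => ⟪y, L w⟫ - t - 1 / γ / 2 * ‖y - (L.comp (adjoint L)) y‖ ^ 2)
      (convex_epigraph_fconj _) (exists_fconj_fconj_ne_top hg)
      (concaveOn_inner_sub_norm_sq _ _ _ (half_pos hγ').le) (by fun_prop) ht
    have hs : fconj g s ≤ ((-c : ℝ) : EReal) := by
      refine (fconj_le_coe_iff _ _ _).2 fun y => ?_
      rw [sub_neg_eq_add]
      exact (hsc y).2.trans (fconj_fconj_le g y)
    have hA := (h s).trans hs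
    rw [EReal.coe_le_coe_iff] at hA ⊢
    have hsw : adjoint L s = w := by
      set d := w - adjoint L s with hd
      have hlin : ∀ a : ℝ, a * ‖d‖ ^ 2 ≤ t + c := by
        intro a
        have h1 := (hsc (L (a • d))).1
        have e : L (a • d) - (L.comp (adjoint L)) (L (a • d)) = 0 := by
          simp only [ContinuousLinearMap.comp_apply, hL, sub_self]
        have e1 : ⟪L (a • d), L w⟫ - ⟪L (a • d), s⟫ = a * ‖d‖ ^ 2 := by
          rw [← ContinuousLinearMap.adjoint_inner_right, ← ContinuousLinearMap.adjoint_inner_right,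
            hL, ← inner_sub_right, ← hd, real_inner_smul_left, real_inner_self_eq_norm_sq]
        simp only [e, norm_zero] at h1
        linarith
      by_contra hne
      have hpos : 0 < ‖d‖ ^ 2 := by
        have : d ≠ 0 := fun h0 => hne (sub_eq_zero.1 h0).symm
        positivity
      have := hlin ((t + c + 1) / ‖d‖ ^ 2)
      rw [div_mul_cancel₀ _ hpos.ne'] at this
      linarith
    have h1 := (hsc (-γ • (s - L w))).1
    have e : -γ • (s - L w) - (L.comp (adjoint L)) (-γ • (s - L w)) = -γ • (s - L w) := by
      simp [hsw, hL]
    have e1 : ⟪-γ • (s - L w), s⟫ - ⟪-γ • (s - L w), L w⟫ = -γ * ‖s - L w‖ ^ 2 := by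
      rw [← inner_sub_right, real_inner_smul_left, real_inner_self_eq_norm_sq]
    have e2 : 1 / γ / 2 * ‖-γ • (s - L w)‖ ^ 2 = γ / 2 * ‖s - L w‖ ^ 2 := by
      rw [norm_smul, mul_pow, Real.norm_eq_abs, sq_abs]
      field_simp
    simp only [e, e2] at h1
    rw [hsw, ← ContinuousLinearMap.adjoint_inner_left, hsw] at hA
    linarith
  · intro h y
    refine EReal.le_of_forall_le_coe fun τ hτ => ?_
    have hB : proxComp L (1 / γ) (fconj g) (adjoint L y) ≤
        ((τ + γ / 2 * ‖y - L (adjoint L y)‖ ^ 2 : ℝ) : EReal) := by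
      refine (proxComp_le_coe_iff_of_isometry hL _ hγ' _ _).2 fun z => ?_
      refine EReal.le_of_forall_le_coe fun σ hσ => ?_
      have h1 := ((fconj_le_coe_iff _ _ _).1 hσ y).trans hτ
      rw [EReal.coe_le_coe_iff] at h1 ⊢
      have e : ⟪z - L (adjoint L z), y - L (adjoint L y)⟫ = ⟪y, z⟫ - ⟪z, L (adjoint L y)⟫ := by
        rw [inner_sub_left, inner_sub_right, inner_sub_right, real_inner_comm y z,
          ← ContinuousLinearMap.adjoint_inner_right L (adjoint L z) y,
          ← ContinuousLinearMap.adjoint_inner_right L (adjoint L z) (L _), hL]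
        ring
      have hsq := mul_nonneg hγ'.le
        (sq_nonneg ‖(z - L (adjoint L z)) + γ • (y - L (adjoint L y))‖)
      rw [norm_add_sq_real, inner_smul_right, norm_smul, mul_pow, Real.norm_eq_abs, sq_abs, e]
        at hsq
      have e' : 1 / γ * (‖z - L (adjoint L z)‖ ^ 2 + 2 * (γ * (⟪y, z⟫ - ⟪z, L (adjoint L y)⟫)) +
          γ ^ 2 * ‖y - L (adjoint L y)‖ ^ 2) = 2 * (1 / γ / 2 * ‖z - L (adjoint L z)‖ ^ 2 +
          (⟪y, z⟫ - ⟪z, L (adjoint L y)⟫) + γ / 2 * ‖y - L (adjoint L y)‖ ^ 2) := by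
        field_simp
      linarith
    have h2 := (h (adjoint L y)).trans hB
    rw [EReal.coe_le_coe_iff, ContinuousLinearMap.adjoint_inner_left] at h2
    rw [EReal.coe_le_coe_iff]
    linarith

theorem proxComp_adjoint_of_coisometry {L : H →L[ℝ] G} (hL : ∀ y, L (adjoint L y) = y)
    (g : G → EReal) {γ : ℝ} (hγ : 0 < γ) (v : G) :
    proxComp L γ g (adjoint L v) = fconj (fconj g) v := by
  refine EReal.eq_of_forall_le_coe_iff fun r => ?_
  have key : ∀ z y, ⟪z, adjoint L v⟫ - r - ‖adjoint L v‖ ^ 2 / (2 * γ) - γ / 2 * ‖L z - y‖ ^ 2 =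
      ⟪y, v⟫ - r - γ / 2 * ‖L z - (y + γ⁻¹ • v)‖ ^ 2 := by
    intro z y
    have e : ‖adjoint L v‖ ^ 2 = ‖v‖ ^ 2 := by
      rw [← real_inner_self_eq_norm_sq, ContinuousLinearMap.adjoint_inner_right, hL,
        real_inner_self_eq_norm_sq]
    rw [ContinuousLinearMap.adjoint_inner_right, e, ← sub_sub, norm_sub_sq_real (L z - y),
      inner_smul_right, norm_smul, mul_pow, Real.norm_eq_abs, sq_abs, inner_sub_left]
    field_simp
    ring
  rw [proxComp_le_coe_iff L g hγ, fconj_le_coe_iff]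
  constructor
  · intro h y
    have h' := h (adjoint L (y + γ⁻¹ • v)) y
    rw [key, hL] at h'
    simpa using h'
  · intro h z y
    refine le_trans ?_ (h y)
    rw [key, EReal.coe_le_coe_iff]
    have := mul_nonneg (half_pos hγ).le (sq_nonneg ‖L z - (y + γ⁻¹ • v)‖)
    linarith

theorem proxComp_eq_top_of_coisometry {L : H →L[ℝ] G} (hL : ∀ y, L (adjoint L y) = y)
    {g : G → EReal} (hg : ∃ y, fconj g y ≠ ⊤) {γ : ℝ} (hγ : 0 < γ) {x : H}
    (hx : adjoint L (L x) ≠ x) : proxComp L γ g x = ⊤ := by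
  refine EReal.eq_of_forall_le_coe_iff fun r => iff_of_false (fun h => ?_) (by simp)
  rw [proxComp_le_coe_iff L g hγ] at h
  obtain ⟨y, hy⟩ := hg
  obtain ⟨τ, hτ, -⟩ := EReal.lt_iff_exists_real_btwn.1 (lt_top_iff_ne_top.2 hy)
  set n := x - adjoint L (L x) with hn
  have hpos : 0 < ‖n‖ ^ 2 := by
    have : n ≠ 0 := fun h0 => hx (sub_eq_zero.1 h0).symm
    positivity
  have hLn : L n = 0 := by rw [hn, map_sub, hL, sub_self]
  have hnx : ⟪n, x⟫ = ‖n‖ ^ 2 := by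
    have : x = n + adjoint L (L x) := by rw [hn, sub_add_cancel]
    rw [this, inner_add_right, ContinuousLinearMap.adjoint_inner_right, hLn, inner_zero_left,
      add_zero, real_inner_self_eq_norm_sq]
  have h1 := (h (((τ + r + ‖x‖ ^ 2 / (2 * γ) + γ / 2 * ‖y‖ ^ 2 + 1) / ‖n‖ ^ 2) • n) y).trans hτ.le
  rw [EReal.coe_le_coe_iff, map_smul, hLn, smul_zero, zero_sub, norm_neg, real_inner_smul_left,
    hnx, div_mul_cancel₀ _ hpos.ne'] at h1
  linarith

theorem proxComp_eq_iInf_of_coisometry {L : H →L[ℝ] G} (hL : ∀ y, L (adjoint L y) = y)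
    {g : G → EReal} (hg : ∃ y, fconj g y ≠ ⊤) {γ : ℝ} (hγ : 0 < γ) (x : H) :
    proxComp L γ g x = ⨅ y : {y : G // adjoint L y = x}, fconj (fconj g) (y : G) := by
  refine le_antisymm (le_iInf ?_) ?_
  · rintro ⟨y, rfl⟩
    exact (proxComp_adjoint_of_coisometry hL g hγ y).le
  · by_cases hx : adjoint L (L x) = x
    · refine (iInf_le _ ⟨L x, hx⟩).trans ?_
      rw [← proxComp_adjoint_of_coisometry hL g hγ, hx]
    · rw [proxComp_eq_top_of_coisometry hL hg hγ hx]
      exact le_top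

theorem proxCocomp_eq_of_coisometry {L : H →L[ℝ] G} (hL : ∀ y, L (adjoint L y) = y)
    {g : G → EReal} (hg : ∃ y, g y ≠ ⊤) {γ : ℝ} (hγ : 0 < γ) (x : H) :
    proxCocomp L γ g x = fconj (fconj g) (L x) := by
  refine EReal.eq_of_forall_le_coe_iff fun r => ?_
  have hγ' : 0 < 1 / γ := one_div_pos.2 hγ
  rw [proxCocomp_le_coe_iff, fconj_le_coe_iff]
  constructor
  · intro h y
    have h' := h (adjoint L y)
    rwa [proxComp_adjoint_of_coisometry hL _ hγ', fconj_fconj_fconj,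
      ContinuousLinearMap.adjoint_inner_left] at h'
  · intro h w
    by_cases hw : adjoint L (L w) = w
    · rw [← hw, proxComp_adjoint_of_coisometry hL _ hγ', fconj_fconj_fconj,
        ContinuousLinearMap.adjoint_inner_left]
      exact h _
    · rw [proxComp_eq_top_of_coisometry hL (exists_fconj_fconj_ne_top hg) hγ' hw]
      exact le_top

end Helpers

/-- (i) If `L` is an isometry then `L ⊙_γ g = L ⊚_γ g`; (ii) if `L` is a coisometry then
`L ⊙_γ g = L* ▷ g**` (infimum attained wherever finite) and `L ⊚_γ g = g** ∘ L`;
(iii) if `L` is invertible with `L⁻¹ = L*`, then all four coincide. -/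
theorem proxComp_proxCocomp_isometry_coisometry
    {H G : Type*} [NormedAddCommGroup H] [InnerProductSpace ℝ H] [CompleteSpace H]
    [NormedAddCommGroup G] [InnerProductSpace ℝ G] [CompleteSpace G]
    (L : H →L[ℝ] G) (hL0 : 0 < ‖L‖) (hL1 : ‖L‖ ≤ 1)
    (g : G → EReal) (hg : ProperE g) (hm : HasAffMinorant g)
    (γ : ℝ) (hγ : 0 < γ) :
    ((ContinuousLinearMap.adjoint L).comp L = ContinuousLinearMap.id ℝ H →
        proxComp L γ g = proxCocomp L γ g) ∧
    (L.comp (ContinuousLinearMap.adjoint L) = ContinuousLinearMap.id ℝ G →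
        (∀ x : H, proxComp L γ g x =
            ⨅ y : {y : G // ContinuousLinearMap.adjoint L y = x}, fconj (fconj g) (y : G)) ∧
        (∀ x : H, proxComp L γ g x ≠ ⊤ → proxComp L γ g x ≠ ⊥ →
            ∃ y : G, ContinuousLinearMap.adjoint L y = x ∧
              proxComp L γ g x = fconj (fconj g) y) ∧
        (∀ x : H, proxCocomp L γ g x = fconj (fconj g) (L x))) ∧
    ((ContinuousLinearMap.adjoint L).comp L = ContinuousLinearMap.id ℝ H ∧
      L.comp (ContinuousLinearMap.adjoint L) = ContinuousLinearMap.id ℝ G →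
        (∀ x : H, proxComp L γ g x =
            ⨅ y : {y : G // ContinuousLinearMap.adjoint L y = x}, fconj (fconj g) (y : G)) ∧
        (∀ x : H, proxComp L γ g x = fconj (fconj g) (L x)) ∧
        (∀ x : H, proxCocomp L γ g x = fconj (fconj g) (L x))) := by
  have hiso : (ContinuousLinearMap.adjoint L).comp L = ContinuousLinearMap.id ℝ H →
      ∀ x, ContinuousLinearMap.adjoint L (L x) = x := fun h x => DFunLike.congr_fun h x
  have hco : L.comp (ContinuousLinearMap.adjoint L) = ContinuousLinearMap.id ℝ G →
      ∀ y, L (ContinuousLinearMap.adjoint L y) = y := fun h y => DFunLike.congr_fun h y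
  have hdom := exists_fconj_ne_top hm
  refine ⟨fun h => proxComp_eq_proxCocomp_of_isometry (hiso h) hg.1 hγ, fun h => ?_, fun h => ?_⟩
  · refine ⟨proxComp_eq_iInf_of_coisometry (hco h) hdom hγ, fun x htop _ => ?_,
      proxCocomp_eq_of_coisometry (hco h) hg.1 hγ⟩
    have hx := not_imp_comm.1 (proxComp_eq_top_of_coisometry (hco h) hdom hγ) htop
    refine ⟨L x, hx, ?_⟩
    rw [← proxComp_adjoint_of_coisometry (hco h) g hγ, hx]
  · refine ⟨proxComp_eq_iInf_of_coisometry (hco h.2) hdom hγ, fun x => ?_,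
      proxCocomp_eq_of_coisometry (hco h.2) hg.1 hγ⟩
    rw [← proxComp_adjoint_of_coisometry (hco h.2) g hγ, hiso h.1]
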